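/- Let Z be a centered Gaussian process on [0,S] with a.s. continuous paths and nonnegative covariance R(s,t) ≥ 0, δ locally bounded measurable, c > 0, and let σ²(t) = 2∫_0^t∫_0^v e^{-δ(w)-δ(v)} R(w,v) dw dv with σ²(S) > 0. Define Y(t) = ∫_0^t e^{-δ(s)} Z(s) ds. Then for all u > 0, P(sup_{t∈[0,S]} Y(t) > u) ≤ 2 Ψ(u/σ(S)), where Ψ is the standard normal tail. -/

import Mathlib

open MeasureTheory ProbabilityTheory intervalIntegral

/-- tail of the standard normal distribution -/
noncomputable def gaussTail (x : ℝ) : ℝ := ((gaussianReal 0 1) (Set.Ioi x)).toReal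

theorem integral_mul_comp_nonpos_of_covariance_nonneg {Ω ι : Type*} [MeasurableSpace Ω] [Fintype ι]
    {P : Measure Ω} {V : Ω → ℝ} {W : ι → Ω → ℝ}
    (hVW : HasGaussianLaw (fun ω => (V ω, fun j => W j ω)) P) (hV : ∫ ω, V ω ∂P = 0)
    (hcov : ∀ j, 0 ≤ cov[V, W j; P]) {g : (ι → ℝ) → ℝ} (hg : Measurable g) {C : ℝ}
    (hC : ∀ x, |g x| ≤ C)
    (hanti : ∀ x b : ι → ℝ, (∀ j, 0 ≤ b j) → (∀ j, cov[V, W j; P] = 0 → b j = 0) →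
      g (x + b) ≤ g x) :
    ∫ ω, V ω * g (fun j => W j ω) ∂P ≤ 0 := by
  have := hVW.isProbabilityMeasure
  have hVg : HasGaussianLaw V P := hVW.fst
  have hWg : HasGaussianLaw (fun ω j => W j ω) P := hVW.snd
  have hVm := hVg.memLp_two
  have hWm : ∀ j, MemLp (W j) 2 P := fun j => (hWg.eval j).memLp_two
  by_cases hvar : Var[V; P] = 0
  · have h0 : ∀ᵐ ω ∂P, V ω = 0 := by
      filter_upwards [(ae_eq_integral_of_variance_eq_zero hVm hvar : _)] with ω hω
      rw [hω, hV]
    rw [MeasureTheory.integral_congr_ae (g := fun _ => (0 : ℝ))]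
    · simp
    · filter_upwards [h0] with ω hω
      simp [hω]
  set β : ι → ℝ := fun j => cov[V, W j; P] / Var[V; P] with hβ
  have hvpos : 0 < Var[V; P] := lt_of_le_of_ne (variance_nonneg _ _) (Ne.symm hvar)
  have hβ0 : ∀ j, 0 ≤ β j := fun j => div_nonneg (hcov j) hvpos.le
  set r : ι → Ω → ℝ := fun j ω => W j ω - β j * V ω with hr
  have hgauss : HasGaussianLaw (fun ω => (fun _ : Unit => V ω, fun j => r j ω)) P := by
    let L : (ℝ × (ι → ℝ)) →L[ℝ] (Unit → ℝ) × (ι → ℝ) :=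
      (ContinuousLinearMap.pi fun _ => ContinuousLinearMap.fst ℝ ℝ (ι → ℝ)).prod
        (ContinuousLinearMap.pi fun j =>
          (ContinuousLinearMap.proj (R := ℝ) (φ := fun _ : ι => ℝ) j).comp (ContinuousLinearMap.snd ℝ ℝ (ι → ℝ))
            - β j • ContinuousLinearMap.fst ℝ ℝ (ι → ℝ))
    exact hVW.map L
  have hind : IndepFun (fun ω (_ : Unit) => V ω) (fun ω j => r j ω) P := by
    refine hgauss.indepFun_of_covariance_eval fun _ j => ?_
    have : cov[V, r j; P] = cov[V, W j; P] - β j * Var[V; P] := by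
      rw [covariance_fun_sub_right hVm (hWm j) (hVm.const_mul _), covariance_const_mul_right,
        covariance_self hVm.aemeasurable]
    rw [this, hβ]
    field_simp
    simp
  have hind' : IndepFun V (fun ω => g (fun j => r j ω)) P :=
    hind.comp (φ := fun x : Unit → ℝ => x ()) (ψ := g) (measurable_pi_apply _) hg
  have hVi := hVg.integrable
  have hWae : AEMeasurable (fun ω j => W j ω) P := hWg.aemeasurable
  have hrae : AEMeasurable (fun ω j => r j ω) P :=
    (hgauss.snd : HasGaussianLaw (fun ω j => r j ω) P).aemeasurable
  have hbdd : ∀ {F : Ω → ι → ℝ}, AEMeasurable F P → Integrable (fun ω => V ω * g (F ω)) P :=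
    fun hF => hVi.mul_bdd (c := C) (hg.comp_aemeasurable hF).aestronglyMeasurable
      (Filter.Eventually.of_forall fun ω => hC _)
  calc ∫ ω, V ω * g (fun j => W j ω) ∂P ≤ ∫ ω, V ω * g (fun j => r j ω) ∂P := by
        refine integral_mono (hbdd hWae) (hbdd hrae) fun ω => ?_
        rcases le_total 0 (V ω) with h | h
        · refine mul_le_mul_of_nonneg_left ?_ h
          convert! hanti (fun j => r j ω) (fun j => β j * V ω) (fun j => mul_nonneg (hβ0 j) h)
            (fun j hj => by simp [hβ, hj]) using 2
          ext j
          simp [hr]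
        · refine mul_le_mul_of_nonpos_left ?_ h
          convert! hanti (fun j => W j ω) (fun j => β j * (- V ω))
            (fun j => mul_nonneg (hβ0 j) (by linarith))
            (fun j hj => by simp [hβ, hj]) using 2
          ext j
          simp [hr]
          ring
    _ = (∫ ω, V ω ∂P) * ∫ ω, g (fun j => r j ω) ∂P :=
        hind'.integral_fun_mul_eq_mul_integral hVi.aestronglyMeasurable
          (hg.comp_aemeasurable hrae).aestronglyMeasurable
    _ ≤ 0 := by rw [hV, zero_mul]

theorem one_le_two_mul_measure_nonneg {Ω : Type*} [MeasurableSpace Ω] {P : Measure Ω}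
    {X : Ω → ℝ} (hX : HasGaussianLaw X P) (h0 : ∫ ω, X ω ∂P = 0) : 1 ≤ 2 * P {ω | 0 ≤ X ω} := by
  have := hX.isProbabilityMeasure
  have hlaw : P.map X = gaussianReal 0 Var[X; P].toNNReal := by
    rw [hX.map_eq_gaussianReal, h0]
  have hneg : (P.map X) (Set.Iic 0) = (P.map X) (Set.Ici 0) := by
    rw [hlaw]
    conv_lhs => rw [← neg_zero (G := ℝ), ← gaussianReal_map_neg, Measure.map_apply measurable_neg measurableSet_Iic]
    congr 1
    ext x
    simp
  have hae := hX.aemeasurable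
  have : IsProbabilityMeasure (P.map X) := Measure.isProbabilityMeasure_map hae
  have hP : P {ω | 0 ≤ X ω} = (P.map X) (Set.Ici 0) :=
    (Measure.map_apply_of_aemeasurable hae measurableSet_Ici).symm
  rw [hP, two_mul]
  nth_rw 1 [← hneg]
  rw [← measure_univ (μ := P.map X), ← Set.Iic_union_Ici (a := (0 : ℝ))]
  exact measure_union_le _ _

theorem measure_exists_sum_gt_le {Ω : Type*} [MeasurableSpace Ω] {P : Measure Ω}
    (n : ℕ) (ξ : ℕ → Ω → ℝ) (hm : ∀ j, Measurable (ξ j)) (hξ : iIndepFun ξ P)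
    (hg : ∀ j, HasGaussianLaw (ξ j) P) (h0 : ∀ j, ∫ ω, ξ j ω ∂P = 0) (u : ℝ) :
    P {ω | ∃ k < n, u < ∑ j ∈ Finset.range (k + 1), ξ j ω} ≤
      2 * P {ω | u < ∑ j ∈ Finset.range n, ξ j ω} := by
  induction n generalizing ξ u with
  | zero => simp
  | succ n ih =>
    have := hξ.isProbabilityMeasure
    have hTm : Measurable (fun ω (j : ℕ) => ξ (j + 1) ω) := measurable_pi_lambda _ fun j => hm _
    have hind : IndepFun (ξ 0) (fun ω (j : ℕ) => ξ (j + 1) ω) P := by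
      refine IndepFun.indepFun_process₀ (hm 0).aemeasurable (fun j => (hm _).aemeasurable) fun J => ?_
      have h1 := hξ.indepFun_finset {0} (J.map (addRightEmbedding 1)) (by simp) hm
      exact h1.comp (φ := fun x : ({0} : Finset ℕ) → ℝ => x ⟨0, by simp⟩)
        (ψ := fun (x : (J.map (addRightEmbedding 1) : Finset ℕ) → ℝ) (j : J) =>
          x ⟨j + 1, by simp⟩) (by fun_prop) (by fun_prop)
    have hmap := (indepFun_iff_map_prod_eq_prod_map_map (hm 0).aemeasurable hTm.aemeasurable).1 hind
    have key : ∀ E : Set (ℝ × (ℕ → ℝ)), MeasurableSet E →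
        P {ω | (ξ 0 ω, fun j => ξ (j + 1) ω) ∈ E} =
          ∫⁻ x, P {ω | (x, fun j => ξ (j + 1) ω) ∈ E} ∂(P.map (ξ 0)) := by
      intro E hE
      have h1 := congrArg (fun ν => ν E) hmap
      rw [Measure.map_apply ((hm 0).prodMk hTm) hE, Measure.prod_apply hE] at h1
      refine h1.trans (lintegral_congr fun x => ?_)
      rw [Measure.map_apply hTm (measurable_prodMk_left hE)]
      rfl
    have hsum : ∀ (k : ℕ) ω, ∑ j ∈ Finset.range (k + 1), ξ j ω =
        ξ 0 ω + ∑ j ∈ Finset.range k, ξ (j + 1) ω := fun k ω => by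
      rw [Finset.sum_range_succ', add_comm]
    have hfm : ∀ k : ℕ, Measurable fun p : ℝ × (ℕ → ℝ) => p.1 + ∑ j ∈ Finset.range k, p.2 j := by
      intro k; fun_prop
    let E₁ : Set (ℝ × (ℕ → ℝ)) := {p | ∃ k < n + 1, u < p.1 + ∑ j ∈ Finset.range k, p.2 j}
    let E₂ : Set (ℝ × (ℕ → ℝ)) := {p | u < p.1 + ∑ j ∈ Finset.range n, p.2 j}
    have hE₂ : MeasurableSet E₂ := measurableSet_lt measurable_const (hfm n)
    have hE₁ : MeasurableSet E₁ := by
      have : E₁ = ⋃ k, ⋃ (_ : k < n + 1), {p | u < p.1 + ∑ j ∈ Finset.range k, p.2 j} := by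
        ext p; simp [E₁]
      rw [this]
      exact .iUnion fun k => .iUnion fun _ => measurableSet_lt measurable_const (hfm k)
    simp_rw [hsum]
    refine (key E₁ hE₁).trans_le (le_of_le_of_eq ?_ (congrArg (2 * ·) (key E₂ hE₂).symm))
    rw [← lintegral_const_mul' _ _ (by simp)]
    refine lintegral_mono fun x => ?_
    simp only [E₁, E₂, Set.mem_ofPred_eq]
    rcases lt_or_ge u x with hx | hx
    · have hS : HasGaussianLaw (fun ω => ∑ j ∈ Finset.range n, ξ (j + 1) ω) P := by
        have h1 := (hξ.precomp (g := fun i : Fin n => (i : ℕ) + 1) (fun a b h => by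
          simpa [Fin.ext_iff] using h)).hasGaussianLaw_fun_sum (fun i => hg _)
        convert! h1 with ω
        rw [Finset.sum_range]
      have hS0 : ∫ ω, ∑ j ∈ Finset.range n, ξ (j + 1) ω ∂P = 0 := by
        rw [integral_finsetSum _ fun j _ => (hg _).integrable]
        simp [h0]
      refine prob_le_one.trans ((one_le_two_mul_measure_nonneg hS hS0).trans ?_)
      gcongr with ω
      intro h
      linarith
    · refine le_trans (measure_mono ?_) ((ih (fun j => ξ (j + 1)) (fun j => hm _) ?_ (fun j => hg _)
        (fun j => h0 _) (u - x)).trans_eq ?_)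
      · rintro ω ⟨k, hk, hu⟩
        rcases k with _ | k
        · simp at hu; linarith
        · exact ⟨k, by omega, by linarith⟩
      · exact hξ.precomp (add_left_injective 1)
      · simp only [sub_lt_iff_lt_add']

theorem integral_prod_le_of_covariance_le {Ω ι : Type*} [MeasurableSpace Ω] [Fintype ι]
    {P : Measure Ω} {B X : ι → Ω → ℝ}
    (h : HasGaussianLaw (fun ω => (fun i => B i ω, fun i => X i ω)) P)
    (hB0 : ∀ i, ∫ ω, B i ω ∂P = 0) (hX0 : ∀ i, ∫ ω, X i ω ∂P = 0)
    (hBX : ∀ i j, cov[B i, X j; P] = 0)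
    (hvar : ∀ i, cov[B i, B i; P] = cov[X i, X i; P])
    (hcov : ∀ i j, cov[B i, B j; P] ≤ cov[X i, X j; P])
    {φ φ' : ℝ → ℝ} (hφ : ∀ x, HasDerivAt φ (φ' x) x) (hφ' : ∀ x, φ' x ≤ 0)
    (hφm : Measurable φ') {C : ℝ} (hC : ∀ x, |φ' x| ≤ C) (h0 : ∀ x, 0 ≤ φ x) (h1 : ∀ x, φ x ≤ 1) :
    ∫ ω, ∏ i, φ (B i ω) ∂P ≤ ∫ ω, ∏ i, φ (X i ω) ∂P := by
  classical
  have := h.isProbabilityMeasure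
  have hBg : ∀ i, HasGaussianLaw (B i) P := fun i =>
    HasGaussianLaw.eval (X := B) h.fst i
  have hXg : ∀ i, HasGaussianLaw (X i) P := fun i =>
    HasGaussianLaw.eval (X := X) h.snd i
  have hB2 := fun i => (hBg i).memLp_two
  have hX2 := fun i => (hXg i).memLp_two
  have hφc : Continuous φ := continuous_iff_continuousAt.2 fun x => (hφ x).continuousAt
  have hanti : Antitone φ := antitone_of_hasDerivAt_nonpos hφ hφ'
  let W : ℝ → ι → Ω → ℝ := fun θ i ω => Real.cos θ * B i ω + Real.sin θ * X i ω
  let V : ℝ → ι → Ω → ℝ := fun θ i ω => -Real.sin θ * B i ω + Real.cos θ * X i ω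
  have hWae : ∀ θ i, AEMeasurable (W θ i) P := fun θ i =>
    ((hBg i).aemeasurable.const_mul _).add ((hXg i).aemeasurable.const_mul _)
  have hVae : ∀ θ i, AEMeasurable (V θ i) P := fun θ i =>
    ((hBg i).aemeasurable.const_mul _).add ((hXg i).aemeasurable.const_mul _)
  have hWd : ∀ θ i ω, HasDerivAt (fun θ => W θ i ω) (V θ i ω) θ := fun θ i ω =>
    ((Real.hasDerivAt_cos θ).mul_const _).add ((Real.hasDerivAt_sin θ).mul_const _)
  let D : ℝ → Ω → ℝ := fun θ ω =>
    ∑ i, (∏ j ∈ Finset.univ.erase i, φ (W θ j ω)) • (φ' (W θ i ω) * V θ i ω)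
  have hprod0 : ∀ (s : Finset ι) (x : ι → ℝ), 0 ≤ ∏ j ∈ s, φ (x j) := fun s x =>
    Finset.prod_nonneg fun _ _ => h0 _
  have hprod1 : ∀ (s : Finset ι) (x : ι → ℝ), ∏ j ∈ s, φ (x j) ≤ 1 := fun s x =>
    Finset.prod_le_one (fun _ _ => h0 _) fun _ _ => h1 _
  have hbound : ∀ θ ω, ‖D θ ω‖ ≤ ∑ i, C * (|B i ω| + |X i ω|) := by
    intro θ ω
    refine (norm_sum_le _ _).trans (Finset.sum_le_sum fun i _ => ?_)
    have hV : |V θ i ω| ≤ |B i ω| + |X i ω| := by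
      refine (abs_add_le _ _).trans (add_le_add ?_ ?_)
      · rw [abs_mul, abs_neg]
        exact mul_le_of_le_one_left (abs_nonneg _) (Real.abs_sin_le_one θ)
      · rw [abs_mul]
        exact mul_le_of_le_one_left (abs_nonneg _) (Real.abs_cos_le_one θ)
    rw [smul_eq_mul, norm_mul, norm_mul, Real.norm_eq_abs, Real.norm_eq_abs, Real.norm_eq_abs,
      abs_of_nonneg (hprod0 _ _)]
    have hC0 : 0 ≤ C := (abs_nonneg _).trans (hC 0)
    calc _ ≤ 1 * (C * (|B i ω| + |X i ω|)) := by
          gcongr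
          · exact hprod1 _ _
          · exact hC _
      _ = _ := one_mul _
  have hFm : ∀ θ, AEStronglyMeasurable (fun ω => ∏ i, φ (W θ i ω)) P := fun θ =>
    (Finset.aemeasurable_fun_prod _ fun i _ =>
      hφc.measurable.comp_aemeasurable (hWae θ i)).aestronglyMeasurable
  have hDm : ∀ θ, AEStronglyMeasurable (D θ) P := fun θ =>
    (Finset.aemeasurable_fun_sum _ fun i _ =>
      (Finset.aemeasurable_fun_prod _ fun j _ =>
        hφc.measurable.comp_aemeasurable (hWae θ j)).mul
        ((hφm.comp_aemeasurable (hWae θ i)).mul (hVae θ i))).aestronglyMeasurable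
  have hder : ∀ θ, HasDerivAt (fun θ => ∫ ω, ∏ i, φ (W θ i ω) ∂P) (∫ ω, D θ ω ∂P) θ := by
    intro θ
    refine (hasDerivAt_integral_of_dominated_loc_of_deriv_le (s := Set.univ)
      (bound := fun ω => ∑ i, C * (|B i ω| + |X i ω|)) Filter.univ_mem
      (Filter.Eventually.of_forall hFm) ?_ (hDm θ)
      (Filter.Eventually.of_forall fun ω θ _ => hbound θ ω) ?_
      (Filter.Eventually.of_forall fun ω θ _ => ?_)).2
    · refine Integrable.of_bound (hFm θ) 1 (Filter.Eventually.of_forall fun ω => ?_)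
      rw [Real.norm_eq_abs, abs_of_nonneg (hprod0 _ _)]
      exact hprod1 _ _
    · exact integrable_finsetSum _ fun i _ =>
        ((hBg i).integrable.abs.add (hXg i).integrable.abs).const_mul C
    · exact HasDerivAt.fun_finsetProd fun i _ => (hφ _).comp θ (hWd θ i ω)
  have hcovVW : ∀ θ i j, cov[V θ i, W θ j; P] =
      Real.sin θ * Real.cos θ * (cov[X i, X j; P] - cov[B i, B j; P]) := by
    intro θ i j
    have e1 : V θ i = (-Real.sin θ) • B i + Real.cos θ • X i := rfl
    have e2 : W θ j = Real.cos θ • B j + Real.sin θ • X j := rfl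
    have hXB : cov[X i, B j; P] = 0 := by rw [covariance_comm, hBX]
    rw [e1, e2, covariance_add_left ((hB2 i).const_smul _) ((hX2 i).const_smul _)
        (((hB2 j).const_smul _).add ((hX2 j).const_smul _)),
      covariance_add_right ((hB2 i).const_smul _) ((hB2 j).const_smul _) ((hX2 j).const_smul _),
      covariance_add_right ((hX2 i).const_smul _) ((hB2 j).const_smul _) ((hX2 j).const_smul _)]
    simp only [covariance_smul_left, covariance_smul_right, hBX, hXB]
    ring
  have hDnonneg : ∀ θ ∈ Set.Ioo 0 (Real.pi / 2), 0 ≤ ∫ ω, D θ ω ∂P := by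
    intro θ hθ
    have hs : 0 < Real.sin θ := Real.sin_pos_of_pos_of_lt_pi hθ.1 (by linarith [hθ.2, Real.pi_pos])
    have hc : 0 < Real.cos θ := Real.cos_pos_of_mem_Ioo ⟨by linarith [hθ.1, Real.pi_pos], hθ.2⟩
    let g : ι → (ι → ℝ) → ℝ := fun i x => (∏ j ∈ Finset.univ.erase i, φ (x j)) * -φ' (x i)
    have hgm : ∀ i, Measurable (g i) := fun i =>
      (Finset.measurable_fun_prod _ fun j _ => hφc.measurable.comp (measurable_pi_apply j)).mul
        (hφm.comp (measurable_pi_apply i)).neg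
    have hgC : ∀ i x, |g i x| ≤ C := fun i x => by
      rw [abs_mul, abs_neg, abs_of_nonneg (hprod0 _ _)]
      exact (mul_le_of_le_one_left (abs_nonneg _) (hprod1 _ _)).trans (hC _)
    have hD : ∀ ω, D θ ω = ∑ i, -(V θ i ω * g i (fun j => W θ j ω)) := fun ω =>
      Finset.sum_congr rfl fun i _ => by simp only [g, smul_eq_mul]; ring
    have hVi : ∀ i, Integrable (V θ i) P := fun i =>
      ((hBg i).integrable.const_mul _).add ((hXg i).integrable.const_mul _)
    have hint : ∀ i, Integrable (fun ω => -(V θ i ω * g i (fun j => W θ j ω))) P := fun i =>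
      ((hVi i).mul_bdd (c := C) ((hgm i).comp_aemeasurable
        (aemeasurable_pi_lambda _ fun j => hWae θ j)).aestronglyMeasurable
        (Filter.Eventually.of_forall fun ω => hgC i _)).neg
    simp_rw [hD]
    rw [integral_finsetSum _ fun i _ => hint i]
    refine Finset.sum_nonneg fun i _ => ?_
    rw [MeasureTheory.integral_neg, neg_nonneg]
    refine integral_mul_comp_nonpos_of_covariance_nonneg (V := V θ i) (W := W θ) ?_ ?_ ?_ (hgm i)
      (hgC i) ?_
    · let p (j : ι) : (ι → ℝ) × (ι → ℝ) →L[ℝ] ℝ :=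
        (ContinuousLinearMap.proj (R := ℝ) (φ := fun _ : ι => ℝ) j).comp
          (ContinuousLinearMap.fst ℝ (ι → ℝ) (ι → ℝ))
      let q (j : ι) : (ι → ℝ) × (ι → ℝ) →L[ℝ] ℝ :=
        (ContinuousLinearMap.proj (R := ℝ) (φ := fun _ : ι => ℝ) j).comp
          (ContinuousLinearMap.snd ℝ (ι → ℝ) (ι → ℝ))
      exact h.map ((-Real.sin θ • p i + Real.cos θ • q i).prod
        (ContinuousLinearMap.pi fun j => Real.cos θ • p j + Real.sin θ • q j))
    · rw [integral_add ((hBg i).integrable.const_mul _) ((hXg i).integrable.const_mul _),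
        MeasureTheory.integral_const_mul, MeasureTheory.integral_const_mul, hB0, hX0]
      simp
    · intro j
      rw [hcovVW]
      exact mul_nonneg (mul_pos hs hc).le (sub_nonneg.2 (hcov i j))
    · intro x b hb hb0
      have hbi : b i = 0 := hb0 i (by rw [hcovVW, hvar]; simp)
      simp only [g, Pi.add_apply, hbi, add_zero]
      refine mul_le_mul_of_nonneg_right ?_ (neg_nonneg.2 (hφ' _))
      exact Finset.prod_le_prod (fun _ _ => h0 _) fun j _ => hanti (le_add_of_nonneg_right (hb j))
  have hmono : MonotoneOn (fun θ => ∫ ω, ∏ i, φ (W θ i ω) ∂P) (Set.Icc 0 (Real.pi / 2)) := by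
    refine monotoneOn_of_deriv_nonneg (convex_Icc _ _)
      (fun θ _ => (hder θ).continuousAt.continuousWithinAt)
      (fun θ _ => (hder θ).differentiableAt.differentiableWithinAt) fun θ hθ => ?_
    rw [interior_Icc] at hθ
    rw [(hder θ).deriv]
    exact hDnonneg θ hθ
  have hpi : (0 : ℝ) ≤ Real.pi / 2 := by positivity
  simpa [W] using hmono (Set.left_mem_Icc.2 hpi) (Set.right_mem_Icc.2 hpi) hpi

theorem exists_abs_deriv_smoothTransition_le : ∃ C, ∀ x, |deriv Real.smoothTransition x| ≤ C := by
  obtain ⟨C, hC⟩ := (isCompact_Icc (a := (0 : ℝ)) (b := 1)).exists_bound_of_continuousOn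
    ((Real.smoothTransition.contDiff (n := 1)).continuous_deriv le_rfl).continuousOn
  refine ⟨C, fun x => ?_⟩
  have hC0 : 0 ≤ C := (norm_nonneg _).trans (hC 0 (by simp))
  by_cases hx : x ∈ Set.Icc (0 : ℝ) 1
  · exact hC x hx
  · have : deriv Real.smoothTransition x = 0 := by
      rcases lt_or_ge x 0 with h | h
      · have : Real.smoothTransition =ᶠ[nhds x] fun _ => 0 := by
          filter_upwards [Iio_mem_nhds h] with y hy
          exact Real.smoothTransition.zero_of_nonpos (le_of_lt hy)
        rw [this.deriv_eq, deriv_const]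
      · have h1 : 1 < x := by
          by_contra! h1
          exact hx ⟨h, h1⟩
        have : Real.smoothTransition =ᶠ[nhds x] fun _ => 1 := by
          filter_upwards [Ioi_mem_nhds h1] with y hy
          exact Real.smoothTransition.one_of_one_le (le_of_lt hy)
        rw [this.deriv_eq, deriv_const]
    simpa [this] using hC0

theorem measure_forall_le_of_covariance_le {Ω ι : Type*} [MeasurableSpace Ω] [Fintype ι]
    {P : Measure Ω} {B X : ι → Ω → ℝ}
    (h : HasGaussianLaw (fun ω => (fun i => B i ω, fun i => X i ω)) P)
    (hB : ∀ i, Measurable (B i)) (hX : ∀ i, Measurable (X i))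
    (hB0 : ∀ i, ∫ ω, B i ω ∂P = 0) (hX0 : ∀ i, ∫ ω, X i ω ∂P = 0)
    (hBX : ∀ i j, cov[B i, X j; P] = 0)
    (hvar : ∀ i, cov[B i, B i; P] = cov[X i, X i; P])
    (hcov : ∀ i j, cov[B i, B j; P] ≤ cov[X i, X j; P]) {a b : ℝ} (hab : a < b) :
    P.real {ω | ∀ i, B i ω ≤ a} ≤ P.real {ω | ∀ i, X i ω ≤ b} := by
  have := h.isProbabilityMeasure
  obtain ⟨C, hC⟩ := exists_abs_deriv_smoothTransition_le
  have hba : 0 < b - a := sub_pos.2 hab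
  let φ : ℝ → ℝ := fun x => Real.smoothTransition ((b - x) / (b - a))
  let φ' : ℝ → ℝ := fun x => deriv Real.smoothTransition ((b - x) / (b - a)) * (-1 / (b - a))
  have hcd : ContDiff ℝ 1 Real.smoothTransition := Real.smoothTransition.contDiff
  have hφ : ∀ x, HasDerivAt φ (φ' x) x := fun x =>
    HasDerivAt.comp x (hcd.differentiable (by simp) _).hasDerivAt
      (((hasDerivAt_id x).const_sub b).div_const (b - a))
  have hd0 : ∀ x, 0 ≤ deriv Real.smoothTransition x := fun x => Real.smoothTransition.monotone.deriv_nonneg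
  have hφ' : ∀ x, φ' x ≤ 0 := fun x =>
    mul_nonpos_of_nonneg_of_nonpos (hd0 _) (div_nonpos_of_nonpos_of_nonneg (by norm_num) hba.le)
  have hφc : Continuous φ' :=
    ((hcd.continuous_deriv le_rfl).comp (by fun_prop)).mul continuous_const
  have hcont : Continuous φ := Real.smoothTransition.continuous.comp (by fun_prop)
  have h0 : ∀ x, 0 ≤ φ x := fun x => Real.smoothTransition.nonneg _
  have h1 : ∀ x, φ x ≤ 1 := fun x => Real.smoothTransition.le_one _
  have hone : ∀ x ≤ a, φ x = 1 := fun x hx =>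
    Real.smoothTransition.one_of_one_le ((one_le_div hba).2 (by linarith))
  have hzero : ∀ x, b < x → φ x = 0 := fun x hx =>
    Real.smoothTransition.zero_of_nonpos (div_nonpos_of_nonpos_of_nonneg (by linarith) hba.le)
  have main := integral_prod_le_of_covariance_le h hB0 hX0 hBX hvar hcov hφ hφ' hφc.measurable
    (C := C * |-1 / (b - a)|) (fun x => by
      rw [abs_mul]; exact mul_le_mul_of_nonneg_right (hC _) (abs_nonneg _)) h0 h1
  have hint : ∀ {Y : ι → Ω → ℝ}, (∀ i, Measurable (Y i)) →
      Integrable (fun ω => ∏ i, φ (Y i ω)) P := fun hY => by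
    refine Integrable.of_bound (Finset.measurable_fun_prod _ fun i _ =>
      hcont.measurable.comp (hY i)).aestronglyMeasurable 1 (Filter.Eventually.of_forall fun ω => ?_)
    rw [Real.norm_eq_abs, abs_of_nonneg (Finset.prod_nonneg fun _ _ => h0 _)]
    exact Finset.prod_le_one (fun _ _ => h0 _) fun _ _ => h1 _
  have hset : ∀ {Y : ι → Ω → ℝ} (c : ℝ), (∀ i, Measurable (Y i)) →
      MeasurableSet {ω | ∀ i, Y i ω ≤ c} := fun c hY => by
    simp only [Set.ofPred_forall]
    exact .iInter fun i => measurableSet_le (hY i) measurable_const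
  calc P.real {ω | ∀ i, B i ω ≤ a} = ∫ ω, ({ω | ∀ i, B i ω ≤ a} : Set Ω).indicator 1 ω ∂P :=
        (integral_indicator_one (hset a hB)).symm
    _ ≤ ∫ ω, ∏ i, φ (B i ω) ∂P := by
        refine integral_mono ((integrable_const 1).indicator (hset a hB)) (hint hB) fun ω => ?_
        refine Set.indicator_le' (g := fun ω => ∏ i, φ (B i ω)) (fun ω hω => ?_)
          (fun ω _ => Finset.prod_nonneg fun _ _ => h0 _) ω
        rw [Finset.prod_eq_one fun i _ => hone _ (hω i)]
        rfl
    _ ≤ ∫ ω, ∏ i, φ (X i ω) ∂P := main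
    _ ≤ ∫ ω, ({ω | ∀ i, X i ω ≤ b} : Set Ω).indicator 1 ω ∂P := by
        refine integral_mono (hint hX) ((integrable_const 1).indicator (hset b hX)) fun ω => ?_
        by_cases hω : ∀ i, X i ω ≤ b
        · rw [Set.indicator_of_mem (show ω ∈ {ω | ∀ i, X i ω ≤ b} from hω)]
          exact Finset.prod_le_one (fun _ _ => h0 _) fun _ _ => h1 _
        · rw [Set.indicator_of_notMem (show ω ∉ {ω | ∀ i, X i ω ≤ b} from hω)]
          push Not at hω
          obtain ⟨i, hi⟩ := hω
          exact (Finset.prod_eq_zero (Finset.mem_univ i) (hzero _ hi)).le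
    _ = P.real {ω | ∀ i, X i ω ≤ b} := integral_indicator_one (hset b hX)

theorem sum_range_succ_eq_pi_sum_proj {n : ℕ} (x : ℕ → ℝ) (k : Fin n) :
    ∑ j ∈ Finset.range (k + 1), x j = ContinuousLinearMap.pi (fun k : Fin n =>
      ∑ j ∈ Finset.univ.filter (fun j : Fin n => j ≤ k),
        ContinuousLinearMap.proj (R := ℝ) (φ := fun _ : Fin n => ℝ) j) (fun j => x j) k := by
  simp only [ContinuousLinearMap.coe_pi', FunLike.coe_sum, Finset.sum_apply,
    ContinuousLinearMap.proj_apply]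
  refine (Finset.sum_nbij (fun j : Fin n => (j : ℕ)) ?_ ?_ ?_ ?_).symm
  · intro j hj
    simp only [Finset.mem_filter, Finset.mem_univ, true_and, Finset.mem_range] at hj ⊢
    omega
  · exact Fin.val_injective.injOn
  · intro j hj
    simp only [Finset.coe_range, Set.mem_Iio] at hj
    have := k.2
    have hjn : j < n := by omega
    exact ⟨⟨j, hjn⟩, Finset.mem_coe.2 (Finset.mem_filter.2 ⟨Finset.mem_univ _, Fin.le_def.2 (Nat.lt_succ_iff.1 hj)⟩), rfl⟩
  · simp

theorem covariance_comp_of_measurePreserving {Ω Ω' : Type*} [MeasurableSpace Ω]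
    [MeasurableSpace Ω'] {P : Measure Ω} {Q : Measure Ω'} {f : Ω' → Ω}
    (hf : MeasurePreserving f Q P) {X Y : Ω → ℝ} (hX : Measurable X) (hY : Measurable Y) :
    cov[fun ω => X (f ω), fun ω => Y (f ω); Q] = cov[X, Y; P] := by
  rw [← hf.map_eq, covariance_map_fun hX.aestronglyMeasurable hY.aestronglyMeasurable
    hf.aemeasurable]

theorem hasGaussianLaw_comp_of_measurePreserving {Ω Ω' E : Type*} [MeasurableSpace Ω]
    [MeasurableSpace Ω'] [TopologicalSpace E] [AddCommMonoid E] [Module ℝ E] [MeasurableSpace E]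
    {P : Measure Ω} {Q : Measure Ω'} {f : Ω' → Ω}
    (hf : MeasurePreserving f Q P) {X : Ω → E} (hX : Measurable X) (h : HasGaussianLaw X P) :
    HasGaussianLaw (fun ω => X (f ω)) Q := by
  refine ⟨?_⟩
  have h1 := h.isGaussian_map
  rw [← hf.map_eq, Measure.map_map hX hf.measurable] at h1
  exact h1

theorem measureReal_exists_gt_le_of_variance_le_covariance {Ω : Type*} [MeasurableSpace Ω]
    {P : Measure Ω} [IsProbabilityMeasure P] (n : ℕ) {T : ℕ → Ω → ℝ} (hT : ∀ k, Measurable (T k))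
    (hg : HasGaussianLaw (fun ω (k : Fin n) => T (k + 1) ω) P) (h0 : ∀ k, ∫ ω, T k ω ∂P = 0)
    (hV0 : Var[T 0; P] = 0) (hmono : Monotone fun k => Var[T k; P])
    (hcov : ∀ i j, i ≤ j → Var[T i; P] ≤ cov[T i, T j; P]) {a b : ℝ} (hab : a < b) :
    P.real {ω | ∃ k < n, b < T (k + 1) ω} ≤
      2 * (gaussianReal 0 Var[T n; P].toNNReal).real (Set.Ioi a) := by
  set V : ℕ → ℝ := fun k => Var[T k; P] with hV
  obtain ⟨Ω', _, ν, ξ, hξm, hξl, hξi, hν⟩ := exists_hasLaw_indepFun (fun _ : ℕ => ℝ)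
    (fun j => gaussianReal 0 (V (j + 1) - V j).toNNReal)
  have hξg : ∀ j, HasGaussianLaw (ξ j) ν := fun j => (hξl j).hasGaussianLaw
  have hξ0 : ∀ j, ∫ ω, ξ j ω ∂ν = 0 := fun j => by
    rw [(hξl j).integral_eq, integral_id_gaussianReal]
  have hξL : ∀ j, MemLp (ξ j) 2 ν := fun j => (hξg j).memLp_two
  have hξcov : ∀ i j, cov[ξ i, ξ j; ν] = if i = j then V (i + 1) - V i else 0 := by
    intro i j
    split_ifs with h
    · subst h
      rw [covariance_self (hξm i).aemeasurable, (hξl i).variance_eq, variance_id_gaussianReal,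
        Real.coe_toNNReal _ (sub_nonneg.2 (hmono (Nat.le_succ i)))]
    · exact (hξi.indepFun h).covariance_eq_zero (hξL i) (hξL j)
  set B : ℕ → Ω' → ℝ := fun k ω => ∑ j ∈ Finset.range k, ξ j ω with hB
  have hBm : ∀ k, Measurable (B k) := fun k => Finset.measurable_fun_sum _ fun j _ => hξm j
  have hBcov : ∀ k l, k ≤ l → cov[B k, B l; ν] = V k := by
    intro k l hkl
    rw [covariance_fun_sum_fun_sum' (fun i _ => hξL i) (fun i _ => hξL i)]
    simp_rw [hξcov, Finset.sum_ite_eq]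
    rw [Finset.sum_congr rfl (g := fun i => V (i + 1) - V i), Finset.sum_range_sub]
    · simp [V, hV0]
    · intro i hi
      rw [if_pos]
      simp only [Finset.mem_range] at hi ⊢
      omega
  have hB0 : ∀ k, ∫ ω, B k ω ∂ν = 0 := by
    intro k
    simp [B, integral_finsetSum _ fun i _ => (hξg i).integrable, hξ0]
  have hBg : HasGaussianLaw (fun ω (k : Fin n) => B (k + 1) ω) ν := by
    have h1 : HasGaussianLaw (fun ω (k : Fin n) => ξ k ω) ν :=
      iIndepFun.hasGaussianLaw (fun i => hξg i) (hξi.precomp Fin.val_injective)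
    have h2 := h1.map_fun (ContinuousLinearMap.pi fun k : Fin n =>
      ∑ j ∈ Finset.univ.filter (fun j : Fin n => j ≤ k),
        ContinuousLinearMap.proj (R := ℝ) (φ := fun _ : Fin n => ℝ) j)
    convert! h2 using 1
    ext ω k
    exact sum_range_succ_eq_pi_sum_proj (fun j => ξ j ω) k
  have hBng : HasGaussianLaw (B n) ν := by
    have h1 : HasGaussianLaw (fun ω => ∑ k : Fin n, ξ k ω) ν :=
      iIndepFun.hasGaussianLaw_fun_sum (fun i : Fin n => hξg i) (hξi.precomp Fin.val_injective)
    convert! h1 using 2 with ω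
    exact Finset.sum_range _
  have hBn : ν.map (B n) = gaussianReal 0 (V n).toNNReal := by
    rw [hBng.map_eq_gaussianReal, hB0, ← covariance_self (hBm n).aemeasurable, hBcov n n le_rfl]
  have hfst : MeasurePreserving Prod.fst (P.prod ν) P := measurePreserving_fst
  have hsnd : MeasurePreserving Prod.snd (P.prod ν) ν := measurePreserving_snd
  have hTvm : Measurable (fun ω (k : Fin n) => T (k + 1) ω) := measurable_pi_lambda _ fun k => hT _
  have hBvm : Measurable (fun ω (k : Fin n) => B (k + 1) ω) := measurable_pi_lambda _ fun k => hBm _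
  have hTvg := hasGaussianLaw_comp_of_measurePreserving hfst hTvm hg
  have hBvg := hasGaussianLaw_comp_of_measurePreserving hsnd hBvm hBg
  have hind : IndepFun (fun ω : Ω × Ω' => fun k : Fin n => B (k + 1) ω.2)
      (fun ω : Ω × Ω' => fun k : Fin n => T (k + 1) ω.1) (P.prod ν) :=
    (indepFun_prod hTvm hBvm).symm
  have key := measure_forall_le_of_covariance_le (P := P.prod ν) (ι := Fin n)
    (B := fun k ω => B (k + 1) ω.2) (X := fun k ω => T (k + 1) ω.1)
    (hind.hasGaussianLaw hBvg hTvg) (fun k => (hBm _).comp measurable_snd)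
    (fun k => (hT _).comp measurable_fst)
    (fun k => by
      have h1 := integral_map hsnd.aemeasurable (f := B (k + 1)) (hBm _).aestronglyMeasurable
      rw [hsnd.map_eq] at h1
      exact h1.symm.trans (hB0 _))
    (fun k => by
      have h1 := integral_map hfst.aemeasurable (f := T (k + 1)) (hT _).aestronglyMeasurable
      rw [hfst.map_eq] at h1
      exact h1.symm.trans (h0 _))
    (fun k l => by
      have h1 : IndepFun (fun ω : Ω × Ω' => B (k + 1) ω.2) (fun ω : Ω × Ω' => T (l + 1) ω.1)
        (P.prod ν) := hind.comp (measurable_pi_apply k) (measurable_pi_apply l)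
      exact h1.covariance_eq_zero (hBvg.eval k).memLp_two (hTvg.eval l).memLp_two)
    (fun k => by
      rw [covariance_comp_of_measurePreserving hsnd (hBm _) (hBm _),
        covariance_comp_of_measurePreserving hfst (hT _) (hT _), hBcov _ _ le_rfl,
        covariance_self (hT _).aemeasurable])
    (fun k l => by
      rw [covariance_comp_of_measurePreserving hsnd (hBm _) (hBm _),
        covariance_comp_of_measurePreserving hfst (hT _) (hT _)]
      rcases le_total k l with h | h
      · rw [hBcov _ _ (by simpa using h)]
        exact hcov _ _ (by simpa using h)
      · rw [covariance_comm, covariance_comm (T _), hBcov _ _ (by simpa using h)]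
        exact hcov _ _ (by simpa using h)) hab
  have hmB : MeasurableSet {ω | ∀ k : Fin n, B (k + 1) ω ≤ a} := by
    rw [Set.ofPred_forall]
    exact MeasurableSet.iInter fun k => measurableSet_le (hBm _) measurable_const
  have hmT : MeasurableSet {ω | ∀ k : Fin n, T (k + 1) ω ≤ b} := by
    rw [Set.ofPred_forall]
    exact MeasurableSet.iInter fun k => measurableSet_le (hT _) measurable_const
  have e1 : (P.prod ν).real {ω | ∀ k : Fin n, B (k + 1) ω.2 ≤ a} =
      ν.real {ω | ∀ k : Fin n, B (k + 1) ω ≤ a} :=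
    hsnd.measureReal_preimage hmB.nullMeasurableSet
  have e2 : (P.prod ν).real {ω | ∀ k : Fin n, T (k + 1) ω.1 ≤ b} =
      P.real {ω | ∀ k : Fin n, T (k + 1) ω ≤ b} :=
    hfst.measureReal_preimage hmT.nullMeasurableSet
  rw [e1, e2] at key
  have c1 : {ω | ∃ k < n, b < T (k + 1) ω} = {ω | ∀ k : Fin n, T (k + 1) ω ≤ b}ᶜ := by
    ext ω
    simp [Fin.exists_iff]
  have c2 : {ω | ∃ k < n, a < B (k + 1) ω} = {ω | ∀ k : Fin n, B (k + 1) ω ≤ a}ᶜ := by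
    ext ω
    simp [Fin.exists_iff]
  have hrefl := measure_exists_sum_gt_le n ξ hξm hξi hξg hξ0 a
  have hrefl' : ν.real {ω | ∃ k < n, a < B (k + 1) ω} ≤ 2 * ν.real {ω | a < B n ω} := by
    have := ENNReal.toReal_mono (by finiteness) hrefl
    simpa [Measure.real, B] using this
  have e3 : ν.real {ω | a < B n ω} = (gaussianReal 0 (V n).toNNReal).real (Set.Ioi a) := by
    rw [← hBn, map_measureReal_apply (hBm n) measurableSet_Ioi]
    rfl
  rw [c1, measureReal_compl hmT]
  rw [c2, measureReal_compl hmB, e3] at hrefl'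
  simp only [probReal_univ] at hrefl' ⊢
  linarith

theorem continuous_variance_of_hasGaussianLaw {Ω E : Type*} [MeasurableSpace Ω]
    [TopologicalSpace E] [FirstCountableTopology E] {P : Measure Ω} {f : E → Ω → ℝ}
    (hf : ∀ x, Measurable (f x)) (hg : ∀ x, HasGaussianLaw (f x) P)
    (h0 : ∀ x, ∫ ω, f x ω ∂P = 0) (hc : ∀ ω, Continuous fun x => f x ω) :
    Continuous fun x => Var[f x; P] := by
  cases isEmpty_or_nonempty E with
  | inl h => exact continuous_of_const fun x => (h.false x).elim
  | inr h =>
  have := (hg h.some).isProbabilityMeasure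
  have hchar : ∀ x, ‖∫ ω, Complex.exp (f x ω * Complex.I) ∂P‖ = Real.exp (-(Var[f x; P] / 2)) := by
    intro x
    have h1 := charFun_gaussianReal (μ := 0) (v := Var[f x; P].toNNReal) 1
    have h2 := (hg x).map_eq_gaussianReal
    rw [h0] at h2
    rw [← h2, charFun_apply_real, integral_map (hf x).aemeasurable (by fun_prop)] at h1
    simp only [Complex.ofReal_one, one_mul] at h1
    rw [h1, Complex.norm_exp]
    simp [Real.coe_toNNReal _ (variance_nonneg _ _)]
  have hcont : Continuous fun x => ∫ ω, Complex.exp (f x ω * Complex.I) ∂P := by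
    refine continuous_of_dominated (bound := fun _ => 1) (fun x => ?_) (fun x => ?_) (by simp) ?_
    · have := hf x
      exact Measurable.aestronglyMeasurable (by fun_prop)
    · exact Filter.Eventually.of_forall fun ω => by simp [Complex.norm_exp]
    · refine Filter.Eventually.of_forall fun ω => ?_
      have := hc ω
      fun_prop
  have heq : (fun x => Var[f x; P]) =
      fun x => -2 * Real.log ‖∫ ω, Complex.exp (f x ω * Complex.I) ∂P‖ := by
    ext x
    rw [hchar, Real.log_exp]
    ring
  rw [heq]
  refine continuous_const.mul (hcont.norm.log fun x => ?_)
  rw [hchar]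
  exact (Real.exp_pos _).ne'

theorem continuous_covariance_of_hasGaussianLaw {Ω : Type*} [MeasurableSpace Ω]
    {P : Measure Ω} {Z : ℝ → Ω → ℝ}
    (hZ : ∀ s, Measurable (Z s)) (hg : ∀ s t, HasGaussianLaw (fun ω => (Z s ω, Z t ω)) P)
    (h0 : ∀ s, ∫ ω, Z s ω ∂P = 0) (hc : ∀ ω, Continuous fun s => Z s ω) :
    Continuous fun p : ℝ × ℝ => cov[Z p.1, Z p.2; P] := by
  have := (hg 0 0).isProbabilityMeasure
  have h1 : Continuous fun s => Var[Z s; P] :=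
    continuous_variance_of_hasGaussianLaw hZ (fun s => (hg s s).fst) h0 hc
  have h2 : Continuous fun p : ℝ × ℝ => Var[Z p.1 + Z p.2; P] := by
    refine continuous_variance_of_hasGaussianLaw (f := fun p : ℝ × ℝ => Z p.1 + Z p.2)
      (fun p => (hZ _).add (hZ _)) (fun p => (hg _ _).add) (fun p => ?_) fun ω => ?_
    · simp only [Pi.add_apply]
      rw [MeasureTheory.integral_add (hg p.1 p.1).fst.integrable (hg p.2 p.2).fst.integrable,
        h0, h0, add_zero]
    · exact ((hc ω).comp continuous_fst).add ((hc ω).comp continuous_snd)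
  have heq : (fun p : ℝ × ℝ => cov[Z p.1, Z p.2; P]) =
      fun p => (Var[Z p.1 + Z p.2; P] - Var[Z p.1; P] - Var[Z p.2; P]) / 2 := by
    ext p
    rw [variance_add (hg p.1 p.1).fst.memLp_two (hg p.2 p.2).fst.memLp_two]
    ring
  rw [heq]
  exact ((h2.sub (h1.comp continuous_fst)).sub (h1.comp continuous_snd)).div_const 2

theorem hasGaussianLaw_of_forall_sum {Ω ι : Type*} [MeasurableSpace Ω] [Fintype ι]
    {P : Measure Ω} {X : ι → Ω → ℝ} (hX : ∀ i, Measurable (X i))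
    (h : ∀ a : ι → ℝ, HasGaussianLaw (fun ω => ∑ i, a i * X i ω) P) :
    HasGaussianLaw (fun ω i => X i ω) P := by
  classical
  refine ⟨isGaussian_of_isGaussian_map fun L => ?_⟩
  rw [Measure.map_map (by fun_prop) (measurable_pi_lambda _ hX)]
  convert! (h fun i => L (Pi.single i 1)).isGaussian_map using 2
  ext ω
  simp only [Function.comp_apply]
  conv_lhs => rw [pi_eq_sum_univ' (fun i => X i ω), map_sum]
  refine Finset.sum_congr rfl fun i _ => ?_
  rw [map_smul, smul_eq_mul, mul_comm]

theorem measureReal_le_of_forall_eventually_mem {Ω : Type*} [MeasurableSpace Ω] {P : Measure Ω}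
    [IsFiniteMeasure P] {A : Set Ω} {B : ℕ → Set Ω} {c : ℕ → ℝ} {l : ℝ}
    (hA : ∀ ω ∈ A, ∀ᶠ n in Filter.atTop, ω ∈ B n) (hB : ∀ᶠ n in Filter.atTop, P.real (B n) ≤ c n)
    (hc : Filter.Tendsto c Filter.atTop (nhds l)) : P.real A ≤ l := by
  have hsub : A ⊆ ⋃ n, ⋂ m ≥ n, B m := by
    intro ω hω
    obtain ⟨n, hn⟩ := Filter.eventually_atTop.1 (hA ω hω)
    exact Set.mem_iUnion.2 ⟨n, Set.mem_iInter₂.2 hn⟩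
  have hmono : Monotone fun n => ⋂ m ≥ n, B m := fun i j hij =>
    Set.iInter₂_mono' fun m hm => ⟨m, le_trans hij hm, le_rfl⟩
  have h1 : Filter.Tendsto (fun n => P.real (⋂ m ≥ n, B m)) Filter.atTop
      (nhds (P.real (⋃ n, ⋂ m ≥ n, B m))) :=
    (ENNReal.tendsto_toReal (by finiteness)).comp (tendsto_measure_iUnion_atTop hmono)
  refine (measureReal_mono hsub).trans (le_of_tendsto_of_tendsto h1 hc ?_)
  filter_upwards [hB] with n hn
  exact (measureReal_mono (Set.iInter₂_subset n le_rfl)).trans hn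

theorem continuous_measureReal_Ioi {m : Measure ℝ} [IsFiniteMeasure m] (h : ∀ x, m {x} = 0) :
    Continuous fun x => m.real (Set.Ioi x) := by
  refine continuous_iff_continuousAt.2 fun x => ?_
  have heq : (fun x => m.real (Set.Ioi x)) =
      fun x => ∫ y, (Set.Ioi x).indicator (fun _ => (1 : ℝ)) y ∂m := by
    ext x
    simp [MeasureTheory.integral_indicator measurableSet_Ioi]
  rw [heq]
  refine continuousAt_of_dominated (bound := fun _ => 1) (Filter.Eventually.of_forall fun z => ?_)
    (Filter.Eventually.of_forall fun z => Filter.Eventually.of_forall fun y => ?_)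
    (integrable_const 1) ?_
  · exact (measurable_const.indicator measurableSet_Ioi).aestronglyMeasurable
  · exact (norm_indicator_le_norm_self _ _).trans (by simp)
  · have hne : ∀ᵐ y ∂m, y ≠ x := by
      rw [ae_iff]
      simpa using h x
    filter_upwards [hne] with y hy
    rcases lt_or_gt_of_ne hy with h1 | h1
    · refine continuousAt_const.congr (f := fun _ => (0 : ℝ)) ?_
      filter_upwards [lt_mem_nhds h1] with z hz
      rw [Set.indicator_of_notMem (by simpa using hz.le)]
    · refine continuousAt_const.congr (f := fun _ => (1 : ℝ)) ?_
      filter_upwards [gt_mem_nhds h1] with z hz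
      rw [Set.indicator_of_mem (by simpa using hz)]

theorem gaussianReal_real_Ioi_eq_gaussTail {v : ℝ} (hv : 0 < v) (a : ℝ) :
    (gaussianReal 0 v.toNNReal).real (Set.Ioi a) = gaussTail (a / √v) := by
  have hs : 0 < √v := Real.sqrt_pos.2 hv
  have h1 : gaussianReal 0 v.toNNReal = (gaussianReal 0 1).map (√v * ·) := by
    rw [gaussianReal_map_const_mul]
    congr 1
    · simp
    · ext
      simp [Real.sq_sqrt hv.le, hv.le]
  rw [h1, map_measureReal_apply (by fun_prop) measurableSet_Ioi, gaussTail, Measure.real]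
  congr 2
  ext x
  simp [div_lt_iff₀' hs]

theorem continuous_gaussTail : Continuous gaussTail :=
  continuous_measureReal_Ioi (m := gaussianReal 0 1) fun x => by
    have := nullSingletonClass_gaussianReal (μ := 0) (v := 1) (by simp)
    exact measure_singleton x

theorem integrableOn_and_setIntegral_comp_ceil_mul {m : Measure ℝ} [IsFiniteMeasure m] {h : ℝ}
    (hh : 0 < h) (f : ℝ → ℝ) (n : ℕ) :
    IntegrableOn (fun s => f (⌈s / h⌉₊ * h)) (Set.Ioc 0 (n * h)) m ∧
    ∫ s in Set.Ioc 0 (n * h), f (⌈s / h⌉₊ * h) ∂m =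
      ∑ k ∈ Finset.range n, m.real (Set.Ioc (k * h) ((k + 1 : ℕ) * h)) * f ((k + 1 : ℕ) * h) := by
  induction n with
  | zero => simp
  | succ n ih =>
    have hu : Set.Ioc 0 ((n + 1 : ℕ) * h) =
        Set.Ioc 0 (n * h) ∪ Set.Ioc (n * h) ((n + 1 : ℕ) * h) := by
      rw [Set.Ioc_union_Ioc_eq_Ioc (by positivity)]
      gcongr
      simp
    have hcongr : Set.EqOn (fun s => f (⌈s / h⌉₊ * h)) (fun _ => f ((n + 1 : ℕ) * h))
        (Set.Ioc (n * h) ((n + 1 : ℕ) * h)) := by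
      intro s hs
      have : ⌈s / h⌉₊ = n + 1 := by
        rw [Nat.ceil_eq_iff (by simp)]
        simp only [Nat.add_sub_cancel]
        exact ⟨(lt_div_iff₀ hh).2 hs.1, (div_le_iff₀ hh).2 hs.2⟩
      simp only [this]
    have hint : IntegrableOn (fun s => f (⌈s / h⌉₊ * h)) (Set.Ioc (n * h) ((n + 1 : ℕ) * h)) m :=
      (integrableOn_congr_fun hcongr measurableSet_Ioc).2 (integrableOn_const (by finiteness))
    rw [hu]
    refine ⟨ih.1.union hint, ?_⟩
    rw [setIntegral_union (Set.Ioc_disjoint_Ioc_of_le le_rfl) measurableSet_Ioc ih.1 hint, ih.2,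
      Finset.sum_range_succ, setIntegral_congr_fun measurableSet_Ioc hcongr]
    simp

theorem tendsto_ceil_div_mul {h : ℕ → ℝ} (hh : ∀ n, 0 < h n)
    (h0 : Filter.Tendsto h Filter.atTop (nhds 0)) {s : ℝ} (hs : 0 ≤ s) :
    Filter.Tendsto (fun n => (⌈s / h n⌉₊ : ℝ) * h n) Filter.atTop (nhds s) := by
  have h1 : Filter.Tendsto (fun n => s + h n) Filter.atTop (nhds s) := by
    simpa using h0.const_add s
  refine tendsto_of_tendsto_of_tendsto_of_le_of_le tendsto_const_nhds h1 (fun n => ?_) fun n => ?_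
  · exact (div_le_iff₀ (hh n)).1 (Nat.le_ceil _)
  · have := (Nat.ceil_lt_add_one (div_nonneg hs (hh n).le)).le
    have := mul_le_mul_of_nonneg_right this (hh n).le
    rwa [add_mul, one_mul, div_mul_cancel₀ _ (hh n).ne'] at this

theorem measureReal_exists_sum_gt_le_of_covariance_nonneg {Ω : Type*} [MeasurableSpace Ω]
    {P : Measure Ω} [IsProbabilityMeasure P] (n : ℕ) {X : ℕ → Ω → ℝ} (hX : ∀ k, Measurable (X k))
    (hg : ∀ n, HasGaussianLaw (fun ω (k : Fin n) => X k ω) P) (h0 : ∀ k, ∫ ω, X k ω ∂P = 0)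
    (hcov : ∀ i j, 0 ≤ cov[X i, X j; P]) {a b : ℝ} (hab : a < b) :
    P.real {ω | ∃ k < n, b < ∑ j ∈ Finset.range (k + 1), X j ω} ≤
      2 * (gaussianReal 0 (∑ i ∈ Finset.range n, ∑ j ∈ Finset.range n,
        cov[X i, X j; P]).toNNReal).real (Set.Ioi a) := by
  have hXg : ∀ k, HasGaussianLaw (X k) P := fun k => (hg (k + 1)).eval (Fin.last k)
  have hXL : ∀ k, MemLp (X k) 2 P := fun k => (hXg k).memLp_two
  set T : ℕ → Ω → ℝ := fun k ω => ∑ j ∈ Finset.range k, X j ω with hTdef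
  have hT : ∀ k, Measurable (T k) := fun k => Finset.measurable_fun_sum _ fun j _ => hX j
  have hTcov : ∀ k l, cov[T k, T l; P] =
      ∑ i ∈ Finset.range k, ∑ j ∈ Finset.range l, cov[X i, X j; P] := fun k l =>
    covariance_fun_sum_fun_sum' (fun i _ => hXL i) (fun i _ => hXL i)
  have hTvar : ∀ k, Var[T k; P] =
      ∑ i ∈ Finset.range k, ∑ j ∈ Finset.range k, cov[X i, X j; P] := fun k => by
    rw [← covariance_self (hT k).aemeasurable, hTcov]
  have hcovT : ∀ i j, i ≤ j → Var[T i; P] ≤ cov[T i, T j; P] := by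
    intro i j hij
    rw [hTvar, hTcov]
    exact Finset.sum_le_sum fun k _ => Finset.sum_le_sum_of_subset_of_nonneg
      (Finset.range_subset_range.2 hij) fun l _ _ => hcov k l
  have hmono : Monotone fun k => Var[T k; P] := by
    intro i j hij
    refine (hcovT i j hij).trans ?_
    simp only [hTvar, hTcov]
    exact Finset.sum_le_sum_of_subset_of_nonneg (Finset.range_subset_range.2 hij)
      fun k _ _ => Finset.sum_nonneg fun l _ => hcov k l
  have hTg : HasGaussianLaw (fun ω (k : Fin n) => T (k + 1) ω) P := by
    have h2 := (hg n).map_fun (ContinuousLinearMap.pi fun k : Fin n =>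
      ∑ j ∈ Finset.univ.filter (fun j : Fin n => j ≤ k),
        ContinuousLinearMap.proj (R := ℝ) (φ := fun _ : Fin n => ℝ) j)
    convert! h2 using 1
    ext ω k
    exact sum_range_succ_eq_pi_sum_proj (fun j => X j ω) k
  have hT0 : ∀ k, ∫ ω, T k ω ∂P = 0 := fun k => by
    simp [T, integral_finsetSum _ fun i _ => (hXg i).integrable, h0]
  rw [← hTvar]
  exact measureReal_exists_gt_le_of_variance_le_covariance n hT hTg hT0 (by simp [hTvar]) hmono
    hcovT hab

theorem tendsto_integral_comp_ceil_div_mul {m : Measure ℝ} [IsFiniteMeasure m] {h : ℕ → ℝ}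
    (hh : ∀ n, 0 < h n) (h0 : Filter.Tendsto h Filter.atTop (nhds 0)) {f : ℝ → ℝ}
    (hf : Continuous f) {t S : ℝ} (ht : 0 ≤ t) (htS : ∀ n, ⌈t / h n⌉₊ * h n ≤ S) :
    Filter.Tendsto (fun n => ∫ s in Set.Ioc 0 (⌈t / h n⌉₊ * h n), f (⌈s / h n⌉₊ * h n) ∂m)
      Filter.atTop (nhds (∫ s in Set.Ioc 0 t, f s ∂m)) := by
  obtain ⟨C, hC⟩ := isCompact_Icc.exists_bound_of_continuousOn (s := Set.Icc 0 S) hf.continuousOn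
  have hC0 : 0 ≤ C := (norm_nonneg _).trans
    (hC 0 ⟨le_rfl, le_trans (mul_nonneg (Nat.cast_nonneg _) (hh 0).le) (htS 0)⟩)
  simp_rw [← MeasureTheory.integral_indicator measurableSet_Ioc]
  refine tendsto_integral_of_dominated_convergence (fun _ => C) (fun n => ?_) (integrable_const C)
    (fun n => Filter.Eventually.of_forall fun s => ?_) (Filter.Eventually.of_forall fun s => ?_)
  · have := hf.measurable
    refine (Measurable.indicator ?_ measurableSet_Ioc).aestronglyMeasurable
    exact this.comp ((measurable_from_nat.comp
      (Nat.measurable_ceil.comp (measurable_id.div_const _))).mul_const _)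
  · by_cases hs : s ∈ Set.Ioc 0 (⌈t / h n⌉₊ * h n)
    · rw [Set.indicator_of_mem hs]
      refine hC _ ⟨mul_nonneg (Nat.cast_nonneg _) (hh n).le, le_trans ?_ (htS n)⟩
      refine mul_le_mul_of_nonneg_right (Nat.cast_le.2 (Nat.ceil_le.2 ?_)) (hh n).le
      exact (div_le_iff₀ (hh n)).2 hs.2
    · rw [Set.indicator_of_notMem hs]
      simpa using hC0
  · by_cases hs : s ∈ Set.Ioc 0 t
    · rw [Set.indicator_of_mem hs]
      refine ((hf.tendsto s).comp (tendsto_ceil_div_mul hh h0 hs.1.le)).congr fun n => ?_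
      have hsn : s ∈ Set.Ioc 0 (⌈t / h n⌉₊ * h n) :=
        ⟨hs.1, hs.2.trans ((div_le_iff₀ (hh n)).1 (Nat.le_ceil _))⟩
      rw [Set.indicator_of_mem hsn]
      rfl
    · rw [Set.indicator_of_notMem hs]
      refine tendsto_const_nhds.congr' ?_
      by_cases hs0 : 0 < s
      · have hts : t < s := not_le.1 fun hst => hs ⟨hs0, hst⟩
        filter_upwards [(tendsto_ceil_div_mul hh h0 ht).eventually_lt_const hts] with n hn
        exact (Set.indicator_of_notMem (fun hs' => absurd hs'.2 (not_le.2 hn)) _).symm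
      · exact Filter.Eventually.of_forall fun n =>
          (Set.indicator_of_notMem (fun hs' => hs0 hs'.1) _).symm

theorem tendsto_sum_sum_mul_measureReal {m : Measure ℝ} [IsFiniteMeasure m] {S : ℝ} (hS : 0 < S)
    {h : ℕ → ℝ} (hh : ∀ n, h n = S / (n + 1 : ℕ)) {K : ℝ × ℝ → ℝ} (hK : Continuous K) :
    Filter.Tendsto (fun n => ∑ i ∈ Finset.range (n + 1), ∑ j ∈ Finset.range (n + 1),
        m.real (Set.Ioc (i * h n) ((i + 1 : ℕ) * h n)) *
          (m.real (Set.Ioc (j * h n) ((j + 1 : ℕ) * h n)) *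
            K ((i + 1 : ℕ) * h n, (j + 1 : ℕ) * h n)))
      Filter.atTop (nhds (∫ p in Set.Ioc 0 S ×ˢ Set.Ioc 0 S, K p ∂(m.prod m))) := by
  have hpos : ∀ n, 0 < h n := fun n => by rw [hh]; positivity
  have hlim : Filter.Tendsto h Filter.atTop (nhds 0) := by
    rw [funext hh]
    exact (tendsto_const_div_atTop_nhds_zero_nat S).comp (Filter.tendsto_add_atTop_nat 1)
  have hnS : ∀ n, ((n + 1 : ℕ) : ℝ) * h n = S := fun n => by
    rw [hh]
    field_simp
  have hceil : ∀ n, ∀ s ∈ Set.Ioc 0 S, (⌈s / h n⌉₊ : ℝ) * h n ∈ Set.Icc 0 S := by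
    intro n s hs
    refine ⟨mul_nonneg (Nat.cast_nonneg _) (hpos n).le, ?_⟩
    rw [← hnS n] at hs ⊢
    refine mul_le_mul_of_nonneg_right (Nat.cast_le.2 (Nat.ceil_le.2 ?_)) (hpos n).le
    exact (div_le_iff₀ (hpos n)).2 hs.2
  have hτ : ∀ n, Measurable fun s : ℝ => (⌈s / h n⌉₊ : ℝ) * h n := fun n =>
    (measurable_from_nat.comp (Nat.measurable_ceil.comp (measurable_id.div_const _))).mul_const _
  obtain ⟨C, hC⟩ := (isCompact_Icc.prod isCompact_Icc).exists_bound_of_continuousOn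
    (s := Set.Icc 0 S ×ˢ Set.Icc 0 S) hK.continuousOn
  have hKτm : ∀ n, Measurable fun p : ℝ × ℝ =>
      K (⌈p.1 / h n⌉₊ * h n, ⌈p.2 / h n⌉₊ * h n) := fun n =>
    hK.measurable.comp (((hτ n).comp measurable_fst).prodMk ((hτ n).comp measurable_snd))
  have hms : MeasurableSet (Set.Ioc 0 S ×ˢ Set.Ioc 0 S) := measurableSet_Ioc.prod measurableSet_Ioc
  have hbound : ∀ n, ∀ᵐ p ∂(m.prod m).restrict (Set.Ioc 0 S ×ˢ Set.Ioc 0 S),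
      ‖K (⌈p.1 / h n⌉₊ * h n, ⌈p.2 / h n⌉₊ * h n)‖ ≤ C := fun n => by
    filter_upwards [ae_restrict_mem hms] with p hp
    exact hC _ ⟨hceil n _ hp.1, hceil n _ hp.2⟩
  have key : Filter.Tendsto (fun n => ∫ p in Set.Ioc 0 S ×ˢ Set.Ioc 0 S,
      K (⌈p.1 / h n⌉₊ * h n, ⌈p.2 / h n⌉₊ * h n) ∂(m.prod m)) Filter.atTop
      (nhds (∫ p in Set.Ioc 0 S ×ˢ Set.Ioc 0 S, K p ∂(m.prod m))) := by
    refine tendsto_integral_of_dominated_convergence (fun _ => C)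
      (fun n => (hKτm n).aestronglyMeasurable) (integrable_const C) hbound ?_
    filter_upwards [ae_restrict_mem hms] with p hp
    exact (hK.tendsto p).comp ((tendsto_ceil_div_mul hpos hlim hp.1.1.le).prodMk_nhds
      (tendsto_ceil_div_mul hpos hlim hp.2.1.le))
  refine key.congr fun n => ?_
  have hint : IntegrableOn (fun p : ℝ × ℝ => K (⌈p.1 / h n⌉₊ * h n, ⌈p.2 / h n⌉₊ * h n))
      (Set.Ioc 0 S ×ˢ Set.Ioc 0 S) (m.prod m) :=
    Integrable.of_bound (hKτm n).aestronglyMeasurable C (hbound n)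
  rw [setIntegral_prod _ hint]
  have h1 := (integrableOn_and_setIntegral_comp_ceil_mul (m := m) (hpos n)
    (fun x => ∫ y in Set.Ioc 0 S, K (x, ⌈y / h n⌉₊ * h n) ∂m) (n + 1)).2
  rw [hnS] at h1
  rw [h1]
  refine Finset.sum_congr rfl fun i _ => ?_
  have h2 := (integrableOn_and_setIntegral_comp_ceil_mul (m := m) (hpos n)
    (fun y => K ((i + 1 : ℕ) * h n, y)) (n + 1)).2
  rw [hnS] at h2
  rw [h2, Finset.mul_sum]

theorem covariance_const_mul_const_mul {Ω : Type*} [MeasurableSpace Ω] {P : Measure Ω} (a b : ℝ)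
    (X Y : Ω → ℝ) :
    cov[fun ω => a * X ω, fun ω => b * Y ω; P] = a * (b * cov[X, Y; P]) := by
  rw [covariance_const_mul_left, covariance_const_mul_right]

theorem measureReal_exists_setIntegral_gt_le {Ω : Type*} [MeasurableSpace Ω] {P : Measure Ω}
    {Z : ℝ → Ω → ℝ} (hZ : ∀ s, Measurable (Z s))
    (hg : ∀ (n : ℕ) (s : Fin n → ℝ), HasGaussianLaw (fun ω i => Z (s i) ω) P)
    (h0 : ∀ s, ∫ ω, Z s ω ∂P = 0) (hc : ∀ ω, Continuous fun s => Z s ω)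
    (hcov : ∀ s t, 0 ≤ s → 0 ≤ t → 0 ≤ cov[Z s, Z t; P]) {m : Measure ℝ} [IsFiniteMeasure m]
    {S : ℝ} (hS : 0 < S) {V : ℝ}
    (hV : V = ∫ p in Set.Ioc 0 S ×ˢ Set.Ioc 0 S, cov[Z p.1, Z p.2; P] ∂(m.prod m)) (hVpos : 0 < V)
    {u : ℝ} (hu : 0 < u) :
    P.real {ω | ∃ t ∈ Set.Icc 0 S, u < ∫ s in Set.Ioc 0 t, Z s ω ∂m} ≤
      2 * gaussTail (u / √V) := by
  have hZg : ∀ s, HasGaussianLaw (Z s) P := fun s => (hg 1 fun _ => s).eval 0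
  have := (hZg 0).isProbabilityMeasure
  have hK : Continuous fun p : ℝ × ℝ => cov[Z p.1, Z p.2; P] :=
    continuous_covariance_of_hasGaussianLaw hZ (fun s t => (hg 2 ![s, t]).prodMk 0 1) h0 hc
  obtain ⟨h, hh⟩ : ∃ h : ℕ → ℝ, ∀ n, h n = S / (n + 1 : ℕ) := ⟨_, fun _ => rfl⟩
  have hpos : ∀ n, 0 < h n := fun n => by rw [hh]; positivity
  have hlim : Filter.Tendsto h Filter.atTop (nhds 0) := by
    rw [funext hh]
    exact (tendsto_const_div_atTop_nhds_zero_nat S).comp (Filter.tendsto_add_atTop_nat 1)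
  have hnS : ∀ n, ((n + 1 : ℕ) : ℝ) * h n = S := fun n => by
    rw [hh]
    field_simp
  obtain ⟨α, hα⟩ : ∃ α : ℕ → ℕ → ℝ,
      ∀ n j, α n j = m.real (Set.Ioc (j * h n) ((j + 1 : ℕ) * h n)) := ⟨_, fun _ _ => rfl⟩
  have hα0 : ∀ n j, 0 ≤ α n j := fun n j => by
    rw [hα]
    exact measureReal_nonneg
  set X : ℕ → ℕ → Ω → ℝ := fun n j ω => α n j * Z ((j + 1 : ℕ) * h n) ω with hX
  set v : ℕ → ℝ := fun n => ∑ i ∈ Finset.range (n + 1), ∑ j ∈ Finset.range (n + 1),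
    cov[X n i, X n j; P] with hv
  have hXcov : ∀ n i j, cov[X n i, X n j; P] =
      α n i * (α n j * cov[Z ((i + 1 : ℕ) * h n), Z ((j + 1 : ℕ) * h n); P]) := fun n i j =>
    covariance_const_mul_const_mul _ _ _ _
  have hvlim : Filter.Tendsto v Filter.atTop (nhds V) := by
    have h1 := tendsto_sum_sum_mul_measureReal (m := m) hS hh hK
    rw [← hV] at h1
    refine h1.congr fun n => ?_
    simp only [hv, hXcov, hα]
  have hXm : ∀ n j, Measurable (X n j) := fun n j => (hZ _).const_mul _
  have hXg : ∀ n N, HasGaussianLaw (fun ω (k : Fin N) => X n k ω) P := fun n N =>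
    (hg N fun k => ((k : ℕ) + 1 : ℕ) * h n).map_fun (ContinuousLinearMap.pi fun k : Fin N =>
      α n k • ContinuousLinearMap.proj (R := ℝ) (φ := fun _ : Fin N => ℝ) k)
  have hX0 : ∀ n k, ∫ ω, X n k ω ∂P = 0 := fun n k => by
    simp only [hX]
    rw [MeasureTheory.integral_const_mul, h0, mul_zero]
  have hXnn : ∀ n i j, 0 ≤ cov[X n i, X n j; P] := fun n i j => by
    rw [hXcov]
    exact mul_nonneg (hα0 _ _) (mul_nonneg (hα0 _ _)
      (hcov _ _ (mul_nonneg (Nat.cast_nonneg _) (hpos n).le)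
        (mul_nonneg (Nat.cast_nonneg _) (hpos n).le)))
  have hpath : ∀ ω, (∃ t ∈ Set.Icc 0 S, u < ∫ s in Set.Ioc 0 t, Z s ω ∂m) →
      ∀ᶠ n in Filter.atTop, ω ∈ {ω | ∃ k < n + 1, u < ∑ j ∈ Finset.range (k + 1), X n j ω} := by
    rintro ω ⟨t, ⟨ht0, htS⟩, htu⟩
    have ht : 0 < t := by
      refine lt_of_le_of_ne ht0 fun h => ?_
      subst h
      simp only [Set.Ioc_self, Measure.restrict_empty, integral_zero_measure] at htu
      exact lt_asymm hu htu
    have hle : ∀ n, ⌈t / h n⌉₊ ≤ n + 1 := fun n => by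
      rw [Nat.ceil_le, div_le_iff₀ (hpos n), hnS]
      exact htS
    have hconv := tendsto_integral_comp_ceil_div_mul (m := m) hpos hlim (hc ω) ht0 (S := S)
      fun n => by
        rw [← hnS n]
        exact mul_le_mul_of_nonneg_right (Nat.cast_le.2 (hle n)) (hpos n).le
    filter_upwards [hconv.eventually_const_lt htu] with n hn
    have hk : ⌈t / h n⌉₊ - 1 + 1 = ⌈t / h n⌉₊ :=
      Nat.sub_add_cancel (Nat.ceil_pos.2 (div_pos ht (hpos n)))
    refine ⟨⌈t / h n⌉₊ - 1, by have := hle n; omega, ?_⟩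
    rw [hk]
    rw [(integrableOn_and_setIntegral_comp_ceil_mul (hpos n) (fun s => Z s ω) _).2] at hn
    simpa only [hX, hα] using hn
  have hstep : ∀ a < u, P.real {ω | ∃ t ∈ Set.Icc 0 S, u < ∫ s in Set.Ioc 0 t, Z s ω ∂m} ≤
      2 * gaussTail (a / √V) := by
    intro a ha
    have hcontV : Filter.Tendsto (fun n => 2 * gaussTail (a / √(v n))) Filter.atTop
        (nhds (2 * gaussTail (a / √V))) :=
      ((continuous_gaussTail.tendsto _).comp (tendsto_const_nhds.div hvlim.sqrt
        (Real.sqrt_pos.2 hVpos).ne')).const_mul 2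
    refine measureReal_le_of_forall_eventually_mem hpath ?_ hcontV
    filter_upwards [hvlim.eventually_const_lt hVpos] with n hn
    rw [← gaussianReal_real_Ioi_eq_gaussTail hn]
    exact measureReal_exists_sum_gt_le_of_covariance_nonneg (n + 1) (hXm n) (hXg n) (hX0 n)
      (hXnn n) ha
  have hcontu : Filter.Tendsto (fun a => 2 * gaussTail (a / √V)) (nhdsWithin u (Set.Iio u))
      (nhds (2 * gaussTail (u / √V))) :=
    ((continuous_const.mul (continuous_gaussTail.comp (continuous_id.div_const _))).tendsto
      u).mono_left nhdsWithin_le_nhds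
  exact ge_of_tendsto hcontu (Filter.eventually_of_mem self_mem_nhdsWithin hstep)

theorem setIntegral_prod_self_eq_two_mul {S : ℝ} (hS : 0 ≤ S) {F : ℝ × ℝ → ℝ}
    (hsymm : ∀ p, F p.swap = F p) (hF : IntegrableOn F (Set.Ioc 0 S ×ˢ Set.Ioc 0 S)) :
    ∫ p in Set.Ioc 0 S ×ˢ Set.Ioc 0 S, F p = 2 * ∫ v in (0 : ℝ)..S, ∫ w in (0 : ℝ)..v, F (v, w) := by
  set ρ : Measure ℝ := volume.restrict (Set.Ioc 0 S) with hρ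
  have hprod : (volume : Measure (ℝ × ℝ)).restrict (Set.Ioc 0 S ×ˢ Set.Ioc 0 S) = ρ.prod ρ := by
    rw [hρ, Measure.prod_restrict]
    rfl
  rw [IntegrableOn, hprod] at hF
  have hle : MeasurableSet {p : ℝ × ℝ | p.2 ≤ p.1} := measurableSet_le measurable_snd measurable_fst
  set J : ℝ × ℝ → ℝ := {p : ℝ × ℝ | p.2 ≤ p.1}.indicator F with hJ
  have hJi : Integrable J (ρ.prod ρ) := hF.indicator hle
  have hJs : Integrable (fun p => J p.swap) (ρ.prod ρ) := hJi.swap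
  have hdiag : ∀ᵐ p ∂ρ.prod ρ, p.1 ≠ p.2 := by
    rw [Measure.ae_prod_iff_ae_ae (p := fun p : ℝ × ℝ => p.1 ≠ p.2)
      (measurableSet_eq_fun measurable_fst measurable_snd).compl]
    refine Filter.Eventually.of_forall fun x => ?_
    rw [ae_iff]
    simp
  have hsum : F =ᵐ[ρ.prod ρ] fun p => J p + J p.swap := by
    filter_upwards [hdiag] with p hp
    rcases lt_or_gt_of_ne hp with h | h
    · rw [hJ, Set.indicator_of_notMem (by simpa using h), Set.indicator_of_mem (by simpa using h.le),
        zero_add, hsymm]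
    · rw [hJ, Set.indicator_of_mem (by simpa using h.le), Set.indicator_of_notMem (by simpa using h),
        add_zero]
  rw [hprod, MeasureTheory.integral_congr_ae hsum, MeasureTheory.integral_add hJi hJs,
    integral_prod_swap, ← two_mul, integral_prod _ hJi, intervalIntegral.integral_of_le hS]
  congr 1
  refine setIntegral_congr_fun measurableSet_Ioc fun v hv => ?_
  have h1 : (fun w => J (v, w)) = (Set.Iic v).indicator fun w => F (v, w) := by
    ext w
    simp [hJ, Set.indicator_apply]
  simp only [h1]
  rw [MeasureTheory.integral_indicator measurableSet_Iic, hρ,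
    Measure.restrict_restrict measurableSet_Iic, intervalIntegral.integral_of_le hv.1.le,
    Set.inter_comm, Set.Ioc_inter_Iic, min_eq_right hv.2]

theorem exists_isFiniteMeasure_exp_neg {δ : ℝ → ℝ} (hδ : Measurable δ) {S M : ℝ}
    (hM : ∀ x ∈ Set.Icc 0 S, |δ x| ≤ M) :
    ∃ m : Measure ℝ, IsFiniteMeasure m ∧
      (∀ (f : ℝ → ℝ), ∀ t ∈ Set.Icc 0 S,
        ∫ s in Set.Ioc 0 t, f s ∂m = ∫ s in (0 : ℝ)..t, Real.exp (-δ s) * f s) ∧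
      (∀ K : ℝ × ℝ → ℝ, ∫ p in Set.Ioc 0 S ×ˢ Set.Ioc 0 S, K p ∂(m.prod m) =
        ∫ p in Set.Ioc 0 S ×ˢ Set.Ioc 0 S, Real.exp (-δ p.2 - δ p.1) * K p) := by
  set w : ℝ → NNReal := fun s => (Real.exp (-δ s)).toNNReal with hw
  have hwm : Measurable w := by fun_prop
  have hwS : ∀ s ∈ Set.Ioc 0 S, w s ≤ (Real.exp M).toNNReal := fun s hs =>
    Real.toNNReal_le_toNNReal (Real.exp_le_exp.2 (neg_le.1 (neg_le_of_abs_le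
      (hM s (Set.Ioc_subset_Icc_self hs)))))
  set ρ : Measure ℝ := volume.restrict (Set.Ioc 0 S) with hρ
  have hfin : IsFiniteMeasure (ρ.withDensity fun s => (w s : ENNReal)) := by
    refine isFiniteMeasure_withDensity (ne_of_lt ?_)
    refine lt_of_le_of_lt (setLIntegral_mono measurable_const fun s hs =>
      ENNReal.coe_le_coe.2 (hwS s hs)) ?_
    rw [lintegral_const]
    finiteness
  refine ⟨ρ.withDensity fun s => (w s : ENNReal), hfin, fun f t ht => ?_, fun K => ?_⟩
  · rw [setIntegral_withDensity_eq_setIntegral_smul hwm _ measurableSet_Ioc, hρ,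
      Measure.restrict_restrict measurableSet_Ioc, intervalIntegral.integral_of_le ht.1,
      Set.inter_eq_left.2 (Set.Ioc_subset_Ioc_right ht.2)]
    simp [hw, NNReal.smul_def, Real.exp_nonneg]
  · have hprod : ρ.prod ρ =
        (volume : Measure (ℝ × ℝ)).restrict (Set.Ioc 0 S ×ˢ Set.Ioc 0 S) := by
      rw [hρ, Measure.prod_restrict]
      rfl
    have hms : MeasurableSet (Set.Ioc 0 S ×ˢ Set.Ioc 0 S) :=
      measurableSet_Ioc.prod measurableSet_Ioc
    have hwm2 : Measurable fun p : ℝ × ℝ => w p.1 * w p.2 := by fun_prop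
    rw [prod_withDensity (by fun_prop) (by fun_prop)]
    simp_rw [← ENNReal.coe_mul]
    rw [setIntegral_withDensity_eq_setIntegral_smul hwm2 _ hms, hprod,
      Measure.restrict_restrict hms, Set.inter_self]
    refine MeasureTheory.integral_congr_ae (Filter.Eventually.of_forall fun p => ?_)
    simp only [hw, NNReal.smul_def, NNReal.coe_mul, Real.coe_toNNReal _ (Real.exp_nonneg _),
      smul_eq_mul, ← Real.exp_add]
    ring_nf

theorem slepian_upper_bound_ruin
    {Ω : Type*} [MeasurableSpace Ω] (μ : Measure Ω) [IsProbabilityMeasure μ]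
    (Z : ℝ → Ω → ℝ) (R : ℝ → ℝ → ℝ) (δ : ℝ → ℝ) (c S : ℝ)
    (hS : 0 < S) (hc : 0 < c)
    (hmeas : ∀ s, Measurable (Z s))
    (hcont : ∀ ω, Continuous fun s => Z s ω)
    (hgauss : ∀ (n : ℕ) (a : Fin n → ℝ) (s : Fin n → ℝ), ∃ v : NNReal,
      Measure.map (fun ω => ∑ i, a i * Z (s i) ω) μ = gaussianReal 0 v)
    (hcov : ∀ s t : ℝ, 0 ≤ s → 0 ≤ t → ∫ ω, Z s ω * Z t ω ∂μ = R s t)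
    (hRnonneg : ∀ s t, 0 ≤ s → 0 ≤ t → 0 ≤ R s t)
    (hδmeas : Measurable δ)
    (hδloc : ∀ K : ℝ, ∃ M : ℝ, ∀ x ∈ Set.Icc (0 : ℝ) K, |δ x| ≤ M)
    (hσS : 0 < 2 * ∫ v in (0 : ℝ)..S, ∫ w in (0 : ℝ)..v, Real.exp (-δ w - δ v) * R w v) :
    ∀ u : ℝ, 0 < u →
      (μ {ω | ∃ t ∈ Set.Icc (0 : ℝ) S,
          u < ∫ s in (0 : ℝ)..t, Real.exp (-δ s) * Z s ω}).toReal ≤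
        2 * gaussTail (u / Real.sqrt
          (2 * ∫ v in (0 : ℝ)..S, ∫ w in (0 : ℝ)..v, Real.exp (-δ w - δ v) * R w v)) := by
  intro u hu
  have hg : ∀ (n : ℕ) (s : Fin n → ℝ), HasGaussianLaw (fun ω i => Z (s i) ω) μ := fun n s =>
    hasGaussianLaw_of_forall_sum (fun i => hmeas (s i)) fun a => by
      obtain ⟨v, hv⟩ := hgauss n a s
      exact ⟨by rw [hv]; infer_instance⟩
  have h0 : ∀ s, ∫ ω, Z s ω ∂μ = 0 := fun s => by
    obtain ⟨v, hv⟩ := hgauss 1 (fun _ => 1) fun _ => s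
    simp only [Finset.univ_unique, Finset.sum_const, Finset.card_singleton, one_smul,
      one_mul] at hv
    rw [← integral_id_gaussianReal (μ := 0) (v := v), ← hv,
      integral_map (hmeas s).aemeasurable (by fun_prop)]
  have hZL : ∀ s, MemLp (Z s) 2 μ := fun s => ((hg 1 fun _ => s).eval 0).memLp_two
  have hK : Continuous fun p : ℝ × ℝ => cov[Z p.1, Z p.2; μ] :=
    continuous_covariance_of_hasGaussianLaw hmeas (fun s t => (hg 2 ![s, t]).prodMk 0 1) h0 hcont
  have hKR : ∀ s t, 0 ≤ s → 0 ≤ t → cov[Z s, Z t; μ] = R s t := fun s t hs ht => by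
    rw [covariance_eq_sub (hZL s) (hZL t), h0, zero_mul, sub_zero, ← hcov s t hs ht]
    rfl
  obtain ⟨M, hM⟩ := hδloc S
  obtain ⟨m, hm, hm1, hm2⟩ := exists_isFiniteMeasure_exp_neg hδmeas hM
  have hms : MeasurableSet (Set.Ioc 0 S ×ˢ Set.Ioc 0 S) := measurableSet_Ioc.prod measurableSet_Ioc
  obtain ⟨C, hC⟩ := (isCompact_Icc.prod isCompact_Icc).exists_bound_of_continuousOn
    (s := Set.Icc 0 S ×ˢ Set.Icc 0 S) hK.continuousOn
  have hint : IntegrableOn (fun p : ℝ × ℝ => Real.exp (-δ p.2 - δ p.1) * cov[Z p.1, Z p.2; μ])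
      (Set.Ioc 0 S ×ˢ Set.Ioc 0 S) := by
    refine IntegrableOn.of_bound ?_ (Measurable.aestronglyMeasurable ?_) (Real.exp (M + M) * C) ?_
    · exact (measure_mono (Set.prod_mono Set.Ioc_subset_Icc_self Set.Ioc_subset_Icc_self)).trans_lt
        (isCompact_Icc.prod isCompact_Icc).measure_lt_top
    · have := hK.measurable
      fun_prop
    · filter_upwards [ae_restrict_mem hms] with p hp
      have hp1 := Set.Ioc_subset_Icc_self hp.1
      have hp2 := Set.Ioc_subset_Icc_self hp.2
      rw [norm_mul, Real.norm_of_nonneg (Real.exp_nonneg _)]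
      refine mul_le_mul (Real.exp_le_exp.2 ?_) (hC p ⟨hp1, hp2⟩) (norm_nonneg _)
        (Real.exp_nonneg _)
      linarith [neg_le_of_abs_le (hM _ hp1), neg_le_of_abs_le (hM _ hp2)]
  have hV : 2 * ∫ v in (0 : ℝ)..S, ∫ w in (0 : ℝ)..v, Real.exp (-δ w - δ v) * R w v =
      ∫ p in Set.Ioc 0 S ×ˢ Set.Ioc 0 S, cov[Z p.1, Z p.2; μ] ∂(m.prod m) := by
    rw [hm2, setIntegral_prod_self_eq_two_mul hS.le (fun p => ?_) hint]
    · congr 1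
      refine intervalIntegral.integral_congr fun v hv => ?_
      rw [Set.uIcc_of_le hS.le] at hv
      refine intervalIntegral.integral_congr fun w hw => ?_
      rw [Set.uIcc_of_le hv.1] at hw
      simp only
      rw [covariance_comm, hKR w v hw.1 hv.1]
    · simp only [Prod.fst_swap, Prod.snd_swap]
      rw [covariance_comm, sub_eq_add_neg, sub_eq_add_neg, add_comm]
  have hmain := measureReal_exists_setIntegral_gt_le hmeas hg h0 hcont
    (fun s t hs ht => by rw [hKR s t hs ht]; exact hRnonneg s t hs ht) hS hV hσS hu
  have hset : {ω | ∃ t ∈ Set.Icc (0 : ℝ) S, u < ∫ s in (0 : ℝ)..t, Real.exp (-δ s) * Z s ω} =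
      {ω | ∃ t ∈ Set.Icc (0 : ℝ) S, u < ∫ s in Set.Ioc 0 t, Z s ω ∂m} := by
    ext ω
    refine exists_congr fun t => and_congr_right fun ht => ?_
    rw [hm1 _ t ht]
  rw [hset]
  exact hmain
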